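/- (Key L⁴ identity for Hermite–BWZ eigenfunctions.) Let λ ∈ ℤ∖{0}, ℓ ∈ ℕ, and let γ : ℤ/λℤ → ℂ. Then ∫_{[0,1]³} |∑_{q∈ℤ/λℤ} γ(q) · h_{λ,q,ℓ}(a,b,c)|⁴ da db dc = ∑_{(a,b)∈ℤ²} | (∑_{q∈ℤ/λℤ} γ(q) conj(γ(q−b)) e^{2πiqa/λ}) · 𝓛_ℓ(π(a²+b²)/|λ|) |², where q−b is subtraction in ℤ/λℤ and e^{2πiqa/λ} is well defined for q ∈ ℤ/λℤ since a ∈ ℤ. -/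

import Mathlib

open MeasureTheory Real Complex
open scoped ComplexConjugate

/-- Physicists' Hermite polynomial `H_ℓ(u) = (-1)^ℓ e^{u²} (d/du)^ℓ e^{-u²}`. -/
noncomputable def hermitePoly (ℓ : ℕ) (u : ℝ) : ℝ :=
  (-1 : ℝ) ^ ℓ * Real.exp (u ^ 2) * iteratedDeriv ℓ (fun t : ℝ => Real.exp (-t ^ 2)) u

/-- Normalised Hermite function `h_ℓ(u) = (√π 2^ℓ ℓ!)^{-1/2} H_ℓ(u) e^{-u²/2}`. -/
noncomputable def hermiteFun (ℓ : ℕ) (u : ℝ) : ℝ :=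
  (Real.sqrt π * 2 ^ ℓ * (ℓ.factorial : ℝ)) ^ (-(1 : ℝ) / 2) *
    hermitePoly ℓ u * Real.exp (-u ^ 2 / 2)

/-- Rescaled Hermite function `h_{ℓ,λ}(u) = (2π|λ|)^{1/4} h_ℓ(√(2π|λ|) u)`. -/
noncomputable def hermiteScaled (ℓ : ℕ) (lam : ℤ) (u : ℝ) : ℝ :=
  (2 * π * |(lam : ℝ)|) ^ ((1 : ℝ) / 4) * hermiteFun ℓ (Real.sqrt (2 * π * |(lam : ℝ)|) * u)

/-- Laguerre polynomial of type 0 and degree ℓ. -/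
noncomputable def laguerrePoly (ℓ : ℕ) (v : ℝ) : ℝ :=
  ∑ k ∈ Finset.range (ℓ + 1), (-1 : ℝ) ^ k * (ℓ.choose (ℓ - k) : ℝ) * v ^ k / (k.factorial : ℝ)

/-- Laguerre function `𝓛_ℓ(v) = L_ℓ(v) e^{-v/2}`. -/
noncomputable def laguerreFun (ℓ : ℕ) (v : ℝ) : ℝ := laguerrePoly ℓ v * Real.exp (-v / 2)

/-- The generalised Berezin–Weil–Zak transform. -/
noncomputable def BWZ (lam q : ℤ) (h : ℝ → ℂ) (x : ℝ × ℝ × ℝ) : ℂ :=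
  ((Real.sqrt |(lam : ℝ)| : ℝ) / (lam : ℝ) : ℝ) *
    ∑' k : ℤ, Complex.exp (-(2 * (π : ℂ) * Complex.I * (q : ℂ) * (k : ℂ)) / (lam : ℂ)) *
      Complex.exp (2 * (π : ℂ) * Complex.I * ((lam : ℂ) * (x.2.2 : ℂ) + (k : ℂ) * (x.2.1 : ℂ))) *
      h ((k : ℝ) / (lam : ℝ) + x.1)

/-- The eigenfunctions `h_{λ,q,ℓ} = BWZ_{λ,q}(h_{ℓ,λ})`. -/
noncomputable def hBWZ (lam q : ℤ) (ℓ : ℕ) : ℝ × ℝ × ℝ → ℂ :=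
  BWZ lam q (fun u => (hermiteScaled ℓ lam u : ℂ))

open Polynomial in
/-- The physicists Hermite polynomials, defined by `H₀ = 1` and `H_{n+1} = 2 X H_n - dH_n/dX`. -/
noncomputable def hermitePolynomial : ℕ → ℂ[X]
  | 0 => 1
  | n + 1 => 2 * X * hermitePolynomial n - derivative (hermitePolynomial n)

section HermitePolynomial

open Polynomial

lemma derivative_hermitePolynomial_succ (n : ℕ) :
    derivative (hermitePolynomial (n + 1)) = (2 * (n + 1 : ℂ)) • hermitePolynomial n := by
  induction n with
  | zero => simp [hermitePolynomial, smul_eq_C_mul, map_ofNat]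
  | succ n ih =>
    rw [hermitePolynomial, derivative_sub, derivative_mul, ih, derivative_smul]
    have h : hermitePolynomial (n + 1) =
      2 * X * hermitePolynomial n - derivative (hermitePolynomial n) := rfl
    simp only [smul_eq_C_mul, derivative_mul, derivative_X, derivative_ofNat]
    push_cast
    simp only [map_mul, map_add, map_one, map_natCast, map_ofNat]
    linear_combination (-2 * (n + 1 : ℂ[X])) * h

lemma derivative_hermitePolynomial (n : ℕ) :
    derivative (hermitePolynomial n) = (2 * (n : ℂ)) • hermitePolynomial (n - 1) := by
  cases n with
  | zero => simp [hermitePolynomial]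
  | succ n => simpa using derivative_hermitePolynomial_succ n

lemma iteratedDeriv_exp_neg_sq (n : ℕ) (u : ℝ) :
    ((iteratedDeriv n (fun t : ℝ => Real.exp (-t ^ 2)) u : ℝ) : ℂ) =
      (-1) ^ n * (hermitePolynomial n).eval (u : ℂ) * (Real.exp (-u ^ 2) : ℂ) := by
  induction n generalizing u with
  | zero => simp [hermitePolynomial]
  | succ n ih =>
    have hsmooth : ContDiff ℝ (n + 1 : ℕ) (fun t : ℝ => Real.exp (-t ^ 2)) := by fun_prop
    have hd : HasDerivAt (iteratedDeriv n (fun t : ℝ => Real.exp (-t ^ 2)))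
        (iteratedDeriv (n + 1) (fun t : ℝ => Real.exp (-t ^ 2)) u) u := by
      rw [iteratedDeriv_succ]
      exact (hsmooth.differentiable_iteratedDeriv n (by norm_cast; omega) u).hasDerivAt
    have h1 := hd.ofReal_comp
    have h2 : HasDerivAt (fun t : ℝ => (Real.exp (-t ^ 2) : ℂ))
        ((Real.exp (-u ^ 2) * (-(2 * u)) : ℝ) : ℂ) u := by
      apply HasDerivAt.ofReal_comp
      simpa using ((hasDerivAt_pow 2 u).neg).exp
    have h3 : HasDerivAt (fun t : ℝ => (hermitePolynomial n).eval (t : ℂ))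
        ((derivative (hermitePolynomial n)).eval (u : ℂ)) u :=
      ((hermitePolynomial n).hasDerivAt (u : ℂ)).comp_ofReal
    have h4 := ((h3.const_mul ((-1 : ℂ) ^ n)).mul h2)
    have h5 := h1.unique (h4.congr_of_eventuallyEq (Filter.Eventually.of_forall fun t => ih t))
    rw [h5, hermitePolynomial]
    simp only [eval_sub, eval_mul, eval_X, eval_ofNat]
    push_cast
    ring

lemma ofReal_hermitePoly (n : ℕ) (u : ℝ) :
    (hermitePoly n u : ℂ) = (hermitePolynomial n).eval (u : ℂ) := by
  rw [hermitePoly, ofReal_mul, iteratedDeriv_exp_neg_sq]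
  have h : (Real.exp (u ^ 2) : ℂ) * (Real.exp (-u ^ 2) : ℂ) = 1 := by
    rw [← ofReal_mul, ← Real.exp_add]; simp
  have h2 : ((-1 : ℂ) ^ n) * (-1) ^ n = 1 := by rw [← mul_pow]; simp
  push_cast at h ⊢
  linear_combination (eval (u : ℂ) (hermitePolynomial n)) * ((-1) ^ n * (-1) ^ n * h + h2)

/-- A polynomial grows more slowly than any Gaussian. -/
lemma exists_norm_eval_le (p : ℂ[X]) :
    ∃ C : ℝ, 0 ≤ C ∧ ∀ v : ℝ, ‖p.eval (v : ℂ)‖ ≤ C * Real.exp (v ^ 2 / 4) := by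
  induction p using Polynomial.induction_on' with
  | add p q hp hq =>
    obtain ⟨C, hC, hp⟩ := hp
    obtain ⟨D, hD, hq⟩ := hq
    refine ⟨C + D, by positivity, fun v => ?_⟩
    rw [eval_add, add_mul]
    exact (norm_add_le _ _).trans (add_le_add (hp v) (hq v))
  | monomial n a =>
    refine ⟨‖a‖ * (n.factorial * Real.exp 1), by positivity, fun v => ?_⟩
    rw [eval_monomial, norm_mul, norm_pow, Complex.norm_real, Real.norm_eq_abs, mul_assoc, mul_assoc,
      ← Real.exp_add]
    gcongr
    have h1 := Real.pow_div_factorial_le_exp |v| (abs_nonneg v) n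
    rw [div_le_iff₀ (by positivity)] at h1
    have h2 : Real.exp |v| ≤ Real.exp (1 + v ^ 2 / 4) := by
      gcongr
      nlinarith [sq_nonneg (|v| / 2 - 1), sq_abs v]
    nlinarith [(Nat.cast_nonneg n.factorial : (0 : ℝ) ≤ n.factorial)]

lemma integrable_eval_mul_cexp (p : ℂ[X]) (z : ℂ) :
    Integrable (fun v : ℝ => p.eval (v + z) * Complex.exp (-((v : ℂ) + z) ^ 2)) := by
  obtain ⟨C, hC, hp⟩ := exists_norm_eval_le (p.comp (X + Polynomial.C z))
  have hg : Integrable (fun v : ℝ =>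
      C * Real.exp (2 * z.re ^ 2 + -(z ^ 2).re) * Real.exp (-(1 / 4) * v ^ 2)) :=
    (integrable_exp_neg_mul_sq (by norm_num)).const_mul _
  refine hg.mono' (by fun_prop) (Filter.Eventually.of_forall fun v => ?_)
  have h1 := hp v
  simp only [eval_comp, eval_add, eval_X, eval_C] at h1
  rw [norm_mul, Complex.norm_exp]
  calc _ ≤ C * Real.exp (v ^ 2 / 4) * Real.exp (-((v : ℂ) + z) ^ 2).re := by gcongr
    _ ≤ _ := by
      rw [mul_assoc, mul_assoc, ← Real.exp_add, ← Real.exp_add]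
      refine mul_le_mul_of_nonneg_left (Real.exp_le_exp.2 ?_) hC
      simp [pow_two]
      nlinarith [sq_nonneg (v + 2 * z.re)]

/-- The moment functional `p ↦ ∫ p(v + z) e^{-(v+z)²} dv`. -/
noncomputable def gaussMoment (z : ℂ) (p : ℂ[X]) : ℂ :=
  ∫ v : ℝ, p.eval (v + z) * Complex.exp (-((v : ℂ) + z) ^ 2)

lemma gaussMoment_sub (z : ℂ) (p q : ℂ[X]) :
    gaussMoment z (p - q) = gaussMoment z p - gaussMoment z q := by
  rw [gaussMoment, gaussMoment, gaussMoment,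
    ← integral_sub (integrable_eval_mul_cexp p z) (integrable_eval_mul_cexp q z)]
  simp [sub_mul]

lemma gaussMoment_add (z : ℂ) (p q : ℂ[X]) :
    gaussMoment z (p + q) = gaussMoment z p + gaussMoment z q := by
  rw [gaussMoment, gaussMoment, gaussMoment,
    ← integral_add (integrable_eval_mul_cexp p z) (integrable_eval_mul_cexp q z)]
  simp [add_mul]

lemma gaussMoment_smul (z a : ℂ) (p : ℂ[X]) :
    gaussMoment z (a • p) = a * gaussMoment z p := by
  rw [gaussMoment, gaussMoment, ← integral_const_mul]
  simp [mul_assoc]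

lemma gaussMoment_one (z : ℂ) : gaussMoment z 1 = (Real.sqrt π : ℂ) := by
  have h := GaussianFourier.integral_cexp_neg_mul_sq_add_real_mul_I (b := 1) (by simp) z.im
  rw [← integral_add_right_eq_self _ z.re] at h
  simp only [gaussMoment, eval_one, one_mul]
  convert h using 1
  · congr 1
    ext v
    congr 1
    push_cast
    conv_lhs => rw [← re_add_im z]
    ring
  · rw [div_one, Real.sqrt_eq_rpow, ofReal_cpow Real.pi_pos.le]
    norm_num

lemma gaussMoment_two_X_mul (z : ℂ) (p : ℂ[X]) :
    gaussMoment z (2 * X * p) = gaussMoment z (derivative p) := by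
  rw [← sub_eq_zero, ← neg_eq_zero, neg_sub, ← gaussMoment_sub, gaussMoment]
  refine integral_eq_zero_of_hasDerivAt_of_integrable (fun v => ?_)
    (integrable_eval_mul_cexp _ z) (integrable_eval_mul_cexp p z)
  have h : HasDerivAt (fun w : ℂ => p.eval (w + z) * Complex.exp (-(w + z) ^ 2))
      ((derivative p).eval (v + z) * Complex.exp (-((v : ℂ) + z) ^ 2) +
        p.eval (v + z) * (Complex.exp (-((v : ℂ) + z) ^ 2) * (-(2 * (v + z))))) v := by
    have h0 : HasDerivAt (fun w : ℂ => w + z) 1 (v : ℂ) := (hasDerivAt_id _).add_const z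
    refine HasDerivAt.mul ?_ ?_
    · exact (p.hasDerivAt ((v : ℂ) + z)).comp_add_const (v : ℂ) z
    · simpa using ((h0.pow 2).neg).cexp
  refine h.comp_ofReal.congr_deriv ?_
  simp only [eval_sub, eval_mul, eval_X, eval_ofNat]
  ring

/-- The pairing of two shifted Hermite polynomials against a Gaussian. -/
noncomputable def hermitePairing (z x y : ℂ) (m n : ℕ) : ℂ :=
  gaussMoment z ((hermitePolynomial m).comp (X + C x) * (hermitePolynomial n).comp (X + C y))

lemma hermitePairing_comm (z x y : ℂ) (m n : ℕ) :
    hermitePairing z x y m n = hermitePairing z y x n m := by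
  rw [hermitePairing, hermitePairing, mul_comm]

lemma hermitePairing_succ_left (z x y : ℂ) (m n : ℕ) :
    hermitePairing z x y (m + 1) n =
      2 * x * hermitePairing z x y m n + 2 * n * hermitePairing z x y m (n - 1) := by
  set P := (hermitePolynomial m).comp (X + C x) with hP
  set Q := (hermitePolynomial n).comp (X + C y) with hQ
  have hdP : derivative P = (derivative (hermitePolynomial m)).comp (X + C x) := by
    rw [hP, derivative_comp]; simp
  have hdQ : derivative Q =
      (2 * (n : ℂ)) • (hermitePolynomial (n - 1)).comp (X + C y) := by
    rw [hQ, derivative_comp, derivative_hermitePolynomial]; simp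
  have key : (hermitePolynomial (m + 1)).comp (X + C x) * Q =
      (2 * x) • (P * Q) + (2 * X * (P * Q) - derivative P * Q) := by
    rw [hermitePolynomial, hdP]
    simp only [sub_comp, mul_comp, X_comp, ofNat_comp, ← hP, smul_eq_C_mul, map_mul, map_ofNat]
    ring
  rw [hermitePairing, key, gaussMoment_add, gaussMoment_smul, gaussMoment_sub,
    gaussMoment_two_X_mul, derivative_mul, gaussMoment_add, hdQ, mul_smul_comm, gaussMoment_smul,
    hermitePairing, hermitePairing]
  ring

lemma hermitePairing_zero_left (z x y : ℂ) (n : ℕ) :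
    hermitePairing z x y 0 n = (2 * y) ^ n * (Real.sqrt π : ℂ) := by
  induction n with
  | zero => simp [hermitePairing, hermitePolynomial, gaussMoment_one]
  | succ n ih =>
    rw [hermitePairing_comm, hermitePairing_succ_left, hermitePairing_comm, ih]
    simp
    ring

lemma hermitePairing_eq_sum (z x y : ℂ) (m n : ℕ) :
    hermitePairing z x y m n = (Real.sqrt π : ℂ) * ∑ k ∈ Finset.range (m + 1),
      (m.choose k : ℂ) * n.descFactorial k * 2 ^ k * (2 * x) ^ (m - k) * (2 * y) ^ (n - k) := by
  induction m generalizing n with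
  | zero => simp [hermitePairing_zero_left, mul_comm]
  | succ m ih =>
    rw [hermitePairing_succ_left, ih, ih, Finset.sum_range_succ' _ (m + 1)]
    have h1 : ∀ k ∈ Finset.range (m + 1),
        (((m + 1).choose (k + 1) : ℕ) : ℂ) * n.descFactorial (k + 1) * 2 ^ (k + 1) *
          (2 * x) ^ (m + 1 - (k + 1)) * (2 * y) ^ (n - (k + 1)) =
        2 * n * ((m.choose k : ℂ) * (n - 1).descFactorial k * 2 ^ k * (2 * x) ^ (m - k) *
          (2 * y) ^ (n - 1 - k)) +
        (m.choose (k + 1) : ℂ) * n.descFactorial (k + 1) * 2 ^ (k + 1) *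
          (2 * x) ^ (m - k) * (2 * y) ^ (n - (k + 1)) := by
      intro k _
      have hn : n.descFactorial (k + 1) = n * (n - 1).descFactorial k := by
        cases n with
        | zero => simp
        | succ n => exact Nat.succ_descFactorial_succ n k
      rw [Nat.choose_succ_succ, Nat.add_sub_add_right, hn, show n - 1 - k = n - (k + 1) by omega]
      push_cast
      ring
    rw [Finset.sum_congr rfl h1, Finset.sum_add_distrib, ← Finset.mul_sum]
    have h2 : ∑ k ∈ Finset.range (m + 1), (m.choose (k + 1) : ℂ) * n.descFactorial (k + 1) *
          2 ^ (k + 1) * (2 * x) ^ (m - k) * (2 * y) ^ (n - (k + 1)) +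
        (2 * x) ^ (m + 1) * (2 * y) ^ n = 2 * x * ∑ k ∈ Finset.range (m + 1),
      (m.choose k : ℂ) * n.descFactorial k * 2 ^ k * (2 * x) ^ (m - k) * (2 * y) ^ (n - k) := by
      rw [Finset.sum_range_succ, Finset.sum_range_succ' _ m, mul_add, Finset.mul_sum]
      simp only [Nat.choose_succ_self, Nat.cast_zero, zero_mul, add_zero]
      congr 1
      · refine Finset.sum_congr rfl fun k hk => ?_
        rw [show m - k = m - (k + 1) + 1 by have := Finset.mem_range.1 hk; omega, pow_succ]
        ring
      · simp [pow_succ]; ring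
    simp only [Nat.choose_zero_right, Nat.descFactorial_zero, pow_zero, Nat.cast_one, Nat.sub_zero,
      one_mul, mul_one]
    linear_combination -(Real.sqrt π : ℂ) * h2

/-- Two shifted Hermite polynomials of equal degree pair to a Laguerre polynomial. -/
lemma hermitePairing_self (z x y : ℂ) (n : ℕ) (v : ℝ) (hv : (v : ℂ) = -2 * x * y) :
    hermitePairing z x y n n =
      (Real.sqrt π * 2 ^ n * n.factorial : ℝ) * (laguerrePoly n v : ℂ) := by
  rw [hermitePairing_eq_sum, laguerrePoly, ← Finset.sum_range_reflect]
  push_cast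
  rw [hv, Finset.mul_sum, Finset.mul_sum]
  refine Finset.sum_congr rfl fun k hk => ?_
  have hk' : k ≤ n := by have := Finset.mem_range.1 hk; omega
  rw [Nat.sub_sub_self hk']
  have h1 : (n.factorial : ℂ) = k.factorial * n.descFactorial (n - k) := by
    have := Nat.factorial_mul_descFactorial (Nat.sub_le n k)
    rw [Nat.sub_sub_self hk'] at this
    exact_mod_cast this.symm
  have h2 : (2 : ℂ) ^ n = 2 ^ (n - k) * 2 ^ k := by rw [← pow_add, Nat.sub_add_cancel hk']
  have h3 : (k.factorial : ℂ) ≠ 0 := by exact_mod_cast k.factorial_ne_zero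
  have h4 : ((-1 : ℂ) ^ k) * (-1) ^ k = 1 := by rw [← mul_pow]; simp
  rw [h1, h2, show -2 * x * y = (-1) * (2 * x * y) by ring]
  simp only [mul_pow]
  field_simp
  linear_combination (-((n.choose (n - k) : ℂ) * x ^ k * y ^ k)) * h4

end HermitePolynomial

section HermiteFunction

open Polynomial

lemma ofReal_hermiteFun (n : ℕ) (u : ℝ) :
    (hermiteFun n u : ℂ) = ((Real.sqrt π * 2 ^ n * (n.factorial : ℝ)) ^ (-(1 : ℝ) / 2) : ℝ) *
      (hermitePolynomial n).eval (u : ℂ) * Complex.exp (-(u : ℂ) ^ 2 / 2) := by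
  rw [hermiteFun, ofReal_mul, ofReal_mul, ofReal_hermitePoly]
  push_cast
  rfl

lemma continuous_hermiteFun (n : ℕ) : Continuous (hermiteFun n) := by
  have h : Continuous fun u : ℝ => (hermiteFun n u : ℂ) := by
    simp only [ofReal_hermiteFun]
    fun_prop
  exact Complex.continuous_re.comp h

lemma exists_abs_hermiteFun_le (n : ℕ) :
    ∃ C : ℝ, 0 ≤ C ∧ ∀ u : ℝ, |hermiteFun n u| ≤ C * (1 + u ^ 2)⁻¹ := by
  obtain ⟨C, hC, h⟩ := exists_norm_eval_le (hermitePolynomial n)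
  set c := (Real.sqrt π * 2 ^ n * (n.factorial : ℝ)) ^ (-(1 : ℝ) / 2) with hc
  have hc0 : 0 ≤ c := by positivity
  refine ⟨c * C * 4, by positivity, fun u => ?_⟩
  have h1 : |hermiteFun n u| = c * ‖(hermitePolynomial n).eval (u : ℂ)‖ * Real.exp (-u ^ 2 / 2) := by
    rw [← Real.norm_eq_abs, ← Complex.norm_real, ofReal_hermiteFun, norm_mul, norm_mul,
      Complex.norm_real, ← hc, Real.norm_of_nonneg hc0, Complex.norm_exp]
    congr 2
    rw [show (-(u : ℂ) ^ 2 / 2) = ((-u ^ 2 / 2 : ℝ) : ℂ) by push_cast; ring, ofReal_re]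
  have h2 : Real.exp (u ^ 2 / 4) * Real.exp (-u ^ 2 / 2) ≤ 4 * (1 + u ^ 2)⁻¹ := by
    rw [← Real.exp_add, show u ^ 2 / 4 + -u ^ 2 / 2 = -(u ^ 2 / 4) by ring, Real.exp_neg,
      ← div_eq_mul_inv, le_div_iff₀ (by positivity), inv_mul_le_iff₀ (by positivity)]
    nlinarith [Real.add_one_le_exp (u ^ 2 / 4)]
  rw [h1]
  calc _ ≤ c * (C * Real.exp (u ^ 2 / 4)) * Real.exp (-u ^ 2 / 2) := by gcongr; exact h u
    _ = c * C * (Real.exp (u ^ 2 / 4) * Real.exp (-u ^ 2 / 2)) := by ring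
    _ ≤ c * C * (4 * (1 + u ^ 2)⁻¹) := by gcongr
    _ = _ := by ring

/-- The ambiguity function of a Hermite function is, up to a phase, a Laguerre function. -/
lemma norm_integral_hermiteFun_mul (n : ℕ) (x y : ℝ) :
    ‖∫ v : ℝ, (hermiteFun n (v + x) : ℂ) * (hermiteFun n v : ℂ) *
        Complex.exp (-(y * v * Complex.I))‖ = |laguerreFun n ((x ^ 2 + y ^ 2) / 2)| := by
  set z : ℂ := (x + y * Complex.I) / 2 with hz
  set w : ℂ := (x - y * Complex.I) / 2 with hw
  set d := Real.sqrt π * 2 ^ n * (n.factorial : ℝ) with hd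
  have hd0 : 0 < d := by positivity
  have hI := Complex.I_sq
  have h1 : ∀ v : ℝ, (hermiteFun n (v + x) : ℂ) * (hermiteFun n v : ℂ) *
        Complex.exp (-(y * v * Complex.I)) =
      ((d ^ (-(1 : ℝ) / 2) : ℝ) ^ 2 * Complex.exp (z ^ 2 - x ^ 2 / 2)) *
      (((hermitePolynomial n).comp (X + C w) * (hermitePolynomial n).comp (X + C (-z))).eval
        ((v : ℂ) + z) * Complex.exp (-((v : ℂ) + z) ^ 2)) := by
    intro v
    rw [ofReal_hermiteFun, ofReal_hermiteFun, ← hd]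
    simp only [eval_mul, eval_comp, eval_add, eval_X, eval_C]
    rw [show (v : ℂ) + z + w = ((v + x : ℝ) : ℂ) by rw [hz, hw]; push_cast; ring,
      show (v : ℂ) + z + -z = v by ring]
    have h2 : Complex.exp (-((v + x : ℝ) : ℂ) ^ 2 / 2) * Complex.exp (-(v : ℂ) ^ 2 / 2) *
        Complex.exp (-(y * v * Complex.I)) =
        Complex.exp (z ^ 2 - x ^ 2 / 2) * Complex.exp (-((v : ℂ) + z) ^ 2) := by
      rw [← Complex.exp_add, ← Complex.exp_add, ← Complex.exp_add]
      congr 1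
      rw [hz]
      push_cast
      ring
    linear_combination ((d ^ (-(1 : ℝ) / 2) : ℝ) : ℂ) ^ 2 *
      eval (((v + x : ℝ)) : ℂ) (hermitePolynomial n) * eval (v : ℂ) (hermitePolynomial n) * h2
  simp_rw [h1]
  rw [integral_const_mul]
  change ‖_ * hermitePairing z w (-z) n n‖ = _
  rw [hermitePairing_self z w (-z) n ((x ^ 2 + y ^ 2) / 2)
    (by rw [hz, hw]; push_cast; linear_combination ((y : ℂ) ^ 2 / 2) * hI), ← hd,
    norm_mul, norm_mul, norm_mul, norm_pow, Complex.norm_real, Complex.norm_real, Complex.norm_real,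
    Complex.norm_exp, laguerreFun, abs_mul, abs_of_pos (Real.exp_pos _), Real.norm_of_nonneg hd0.le,
    Real.norm_of_nonneg (by positivity : 0 ≤ d ^ (-(1 : ℝ) / 2)), Real.norm_eq_abs]
  have h3 : (d ^ (-(1 : ℝ) / 2)) ^ 2 * d = 1 := by
    rw [← Real.rpow_natCast, ← Real.rpow_mul hd0.le]
    norm_num
    rw [Real.rpow_neg_one, inv_mul_cancel₀ hd0.ne']
  have h4 : (z ^ 2 - (x : ℂ) ^ 2 / 2).re = -((x ^ 2 + y ^ 2) / 2) / 2 := by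
    rw [show z ^ 2 - (x : ℂ) ^ 2 / 2 =
      ((-((x ^ 2 + y ^ 2) / 2) / 2 : ℝ) : ℂ) + ((x * y / 2 : ℝ) : ℂ) * Complex.I by
        rw [hz]; push_cast; linear_combination ((y : ℂ) ^ 2 / 4) * hI]
    rw [add_re, ofReal_re, re_ofReal_mul, I_re, mul_zero, add_zero]
  rw [h4]
  linear_combination (Real.exp (-((x ^ 2 + y ^ 2) / 2) / 2) *
    |laguerrePoly n ((x ^ 2 + y ^ 2) / 2)|) * h3

end HermiteFunction

section PeriodicParseval

/-- The character `x ↦ e^{2πinx}` of the real line. -/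
noncomputable def expChar (n : ℤ) (x : ℝ) : ℂ := Complex.exp (2 * π * Complex.I * (n * x))

@[fun_prop]
lemma continuous_expChar (n : ℤ) : Continuous (expChar n) := by
  unfold expChar; fun_prop

lemma norm_expChar (n : ℤ) (x : ℝ) : ‖expChar n x‖ = 1 := by
  rw [expChar, Complex.norm_exp]
  simp

lemma expChar_add (m n : ℤ) (x : ℝ) : expChar (m + n) x = expChar m x * expChar n x := by
  rw [expChar, expChar, expChar, ← Complex.exp_add]
  push_cast
  ring_nf

lemma conj_expChar (n : ℤ) (x : ℝ) : conj (expChar n x) = expChar (-n) x := by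
  rw [expChar, expChar, ← Complex.exp_conj]
  simp [Complex.conj_ofNat]

lemma hasSum_sq_norm_integral_mul_expChar {f : ℝ → ℂ} (hf : Continuous f) :
    HasSum (fun n : ℤ => ‖∫ x in (0:ℝ)..1, f x * expChar (-n) x‖ ^ 2)
      (∫ x in (0:ℝ)..1, ‖f x‖ ^ 2) := by
  have hL2 : MemLp f 2 (volume.restrict (Set.Ioc 0 1)) := by
    obtain ⟨C, hC⟩ := isCompact_Icc.exists_bound_of_continuousOn (hf.continuousOn (s := Set.Icc 0 1))
    refine MemLp.of_bound hf.aestronglyMeasurable C ?_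
    filter_upwards [ae_restrict_mem measurableSet_Ioc] with x hx
    exact hC x ⟨hx.1.le, hx.2⟩
  have h := hasSum_sq_fourierCoeffOn (zero_lt_one' ℝ) hL2
  simp only [sub_zero, inv_one, one_smul] at h
  convert h using 2 with n
  rw [fourierCoeffOn_eq_integral]
  simp only [sub_zero, div_one, one_smul, fourier_coe_apply, smul_eq_mul]
  congr 2
  refine intervalIntegral.integral_congr fun x _ => ?_
  simp only [expChar]
  rw [mul_comm]
  congr 2
  push_cast
  ring

lemma integral_expChar (n : ℤ) : ∫ x in (0:ℝ)..1, expChar n x = if n = 0 then 1 else 0 := by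
  split_ifs with h
  · simp [h, expChar]
  · have hn : (2 * π * Complex.I * n : ℂ) ≠ 0 := by
      have : (n : ℂ) ≠ 0 := by exact_mod_cast h
      simp [this, Real.pi_ne_zero]
    have h1 : ∀ x : ℝ, expChar n x = Complex.exp (2 * π * Complex.I * n * x) := fun x => by
      rw [expChar]; ring_nf
    simp_rw [h1]
    rw [integral_exp_mul_complex hn]
    rw [show (2 * π * Complex.I * n * (1 : ℝ) : ℂ) = n * (2 * π * Complex.I) by push_cast; ring,
      Complex.exp_int_mul_two_pi_mul_I]
    simp

variable {c : ℤ → ℂ}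

lemma continuous_tsum_mul_expChar (hc : Summable fun k => ‖c k‖) :
    Continuous fun x : ℝ => ∑' k, c k * expChar k x :=
  continuous_tsum (fun k => by fun_prop) hc fun k x => by rw [norm_mul, norm_expChar, mul_one]

lemma integral_tsum_mul_expChar_mul (hc : Summable fun k => ‖c k‖) {g : ℝ → ℂ}
    (hg : Continuous g) :
    ∫ x in (0:ℝ)..1, (∑' k, c k * expChar k x) * g x =
      ∑' k, c k * ∫ x in (0:ℝ)..1, expChar k x * g x := by
  obtain ⟨C, hC⟩ := isCompact_Icc.exists_bound_of_continuousOn (hg.continuousOn (s := Set.Icc 0 1))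
  have h := intervalIntegral.hasSum_integral_of_dominated_convergence (a := 0) (b := 1)
    (μ := volume) (F := fun k x => c k * (expChar k x * g x))
    (f := fun x => (∑' k, c k * expChar k x) * g x) (fun k _ => ‖c k‖ * C)
    (fun k => by fun_prop)
    (fun k => Filter.Eventually.of_forall fun x hx => by
      rw [Set.uIoc_of_le zero_le_one] at hx
      rw [norm_mul, norm_mul, norm_expChar, one_mul]
      gcongr
      exact hC x ⟨hx.1.le, hx.2⟩)
    (Filter.Eventually.of_forall fun x _ => hc.mul_right C)
    (by simp)
    (Filter.Eventually.of_forall fun x _ => by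
      have h1 : Summable fun k => c k * expChar k x := by
        refine Summable.of_norm ?_
        simpa [norm_mul, norm_expChar] using hc
      simpa [mul_assoc] using h1.hasSum.mul_right (g x))
  rw [← h.tsum_eq]
  simp_rw [intervalIntegral.integral_const_mul]

lemma integral_tsum_mul_expChar (hc : Summable fun k => ‖c k‖) (j : ℤ) :
    ∫ x in (0:ℝ)..1, (∑' k, c k * expChar k x) * expChar (-j) x = c j := by
  rw [integral_tsum_mul_expChar_mul hc (continuous_expChar _)]
  simp_rw [← expChar_add, integral_expChar]
  rw [tsum_eq_single j fun k hk => by rw [if_neg (by omega), mul_zero]]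
  simp

/-- The fourth moment of an absolutely convergent Fourier series, in terms of the
autocorrelation of its coefficients. -/
lemma hasSum_sq_norm_autocorrelation (hc : Summable fun k => ‖c k‖) :
    HasSum (fun n : ℤ => ‖∑' k, c k * conj (c (k - n))‖ ^ 2)
      (∫ x in (0:ℝ)..1, ‖∑' k, c k * expChar k x‖ ^ 4) := by
  set F : ℝ → ℂ := fun x => ∑' k, c k * expChar k x with hF
  have hFc : Continuous F := continuous_tsum_mul_expChar hc
  have h := hasSum_sq_norm_integral_mul_expChar (f := fun x => F x * conj (F x)) (by fun_prop)
  convert h using 2 with n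
  · congr 2
    have h1 : ∀ x, F x * conj (F x) * expChar (-n) x = F x * (conj (F x) * expChar (-n) x) :=
      fun x => mul_assoc _ _ _
    simp_rw [h1]
    rw [integral_tsum_mul_expChar_mul hc (by fun_prop)]
    congr 1
    ext k
    congr 1
    rw [← integral_tsum_mul_expChar hc (k - n), ← intervalIntegral.intervalIntegral_conj]
    congr 1
    ext x
    rw [map_mul, conj_expChar, show - -(k - n) = k + -n by ring, expChar_add]
    ring
  · ext x
    rw [norm_mul, RCLike.norm_conj]
    ring

lemma summable_norm_comp_addRight_restrict {f : C(ℝ, ℂ)} {C : ℝ}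
    (hf : ∀ u, ‖f u‖ ≤ C * (1 + u ^ 2)⁻¹) (K : TopologicalSpace.Compacts ℝ) :
    Summable fun n : ℤ => ‖(f.comp (ContinuousMap.addRight (n : ℝ))).restrict K‖ := by
  have hO : f =O[Filter.cocompact ℝ] fun x : ℝ => |x| ^ (-2 : ℝ) := by
    refine Asymptotics.IsBigO.of_bound C ?_
    have h0 : ∀ᶠ x : ℝ in Filter.cocompact ℝ, x ≠ 0 :=
      (isCompact_singleton (x := (0:ℝ))).compl_mem_cocompact
    have hC : 0 ≤ C := by simpa using (norm_nonneg _).trans (hf 0)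
    filter_upwards [h0] with x hx
    refine (hf x).trans ?_
    rw [Real.norm_of_nonneg (by positivity), Real.rpow_neg (abs_nonneg x)]
    norm_num
    gcongr
    linarith
  exact summable_of_isBigO (Real.summable_abs_int_rpow one_lt_two)
    ((isBigO_norm_restrict_cocompact f two_pos hO K).comp_tendsto Int.tendsto_coe_cofinite)

lemma continuous_periodization {f : C(ℝ, ℂ)} {C : ℝ} (hf : ∀ u, ‖f u‖ ≤ C * (1 + u ^ 2)⁻¹) :
    Continuous fun x : ℝ => ∑' n : ℤ, f (x + n) := by
  convert (∑' n : ℤ, f.comp (ContinuousMap.addRight (n : ℝ))).continuous using 2 with x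
  rw [← ContinuousMap.tsum_apply (ContinuousMap.summable_of_locally_summable_norm
    (summable_norm_comp_addRight_restrict hf))]
  simp

open FourierTransform in
/-- Parseval's identity for the periodization of a decaying function. -/
lemma hasSum_sq_norm_fourier_periodization {f : C(ℝ, ℂ)} {C : ℝ}
    (hf : ∀ u, ‖f u‖ ≤ C * (1 + u ^ 2)⁻¹) :
    HasSum (fun m : ℤ => ‖𝓕 (f : ℝ → ℂ) m‖ ^ 2)
      (∫ x in (0:ℝ)..1, ‖∑' n : ℤ, f (x + n)‖ ^ 2) := by
  have hs := summable_norm_comp_addRight_restrict hf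
  convert hasSum_sq_norm_integral_mul_expChar (continuous_periodization hf) using 2 with m
  rw [← Real.fourierCoeff_tsum_comp_add hs, fourierCoeff_eq_intervalIntegral _ m 0]
  simp only [div_one, one_smul, zero_add]
  congr 2
  refine intervalIntegral.integral_congr fun x _ => ?_
  simp only [Function.Periodic.lift_coe, zsmul_one, smul_eq_mul, fourier_coe_apply]
  rw [← ContinuousMap.tsum_apply (ContinuousMap.summable_of_locally_summable_norm hs), mul_comm]
  simp [expChar, mul_assoc]

end PeriodicParseval

lemma integral_eq_tsum_prod_of_hasSum {g : ℤ → ℝ → ℝ} {G : ℝ → ℝ} {T : ℤ → ℤ → ℝ}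
    (hg : ∀ n, Continuous (g n)) (hg0 : ∀ n x, 0 ≤ g n x) (hT0 : ∀ n m, 0 ≤ T n m)
    (hG : ∀ x, HasSum (fun n => g n x) (G x))
    (hT : ∀ n, HasSum (T n) (∫ x in (0:ℝ)..1, g n x)) :
    ∫ x in (0:ℝ)..1, G x = ∑' p : ℤ × ℤ, T p.1 p.2 := by
  have hG' : G = fun x => ∑' n, g n x := funext fun x => (hG x).tsum_eq.symm
  have hmeas : ∀ n, Measurable fun x => ENNReal.ofReal (g n x) := fun n =>
    (hg n).measurable.ennreal_ofReal
  have hGE : ∀ x, ENNReal.ofReal (G x) = ∑' n, ENNReal.ofReal (g n x) := fun x => by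
    rw [← (hG x).tsum_eq, ENNReal.ofReal_tsum_of_nonneg (fun n => hg0 n x) (hG x).summable]
  have hGm : Measurable G := by
    have : G = fun x => (∑' n, ENNReal.ofReal (g n x)).toReal := by
      ext x
      rw [← hGE, ENNReal.toReal_ofReal ((hG x).nonneg fun n => hg0 n x)]
    rw [this]
    exact (Measurable.tsum hmeas).ennreal_toReal
  rw [intervalIntegral.integral_of_le zero_le_one, integral_eq_lintegral_of_nonneg_ae
    (Filter.Eventually.of_forall fun x => (hG x).nonneg fun n => hg0 n x)
    hGm.aestronglyMeasurable]
  simp_rw [hGE]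
  rw [lintegral_tsum fun n => (hmeas n).aemeasurable]
  have h1 : ∀ n, ∫⁻ x in Set.Ioc (0:ℝ) 1, ENNReal.ofReal (g n x) =
      ∑' m, ENNReal.ofReal (T n m) := fun n => by
    rw [← ENNReal.ofReal_tsum_of_nonneg (hT0 n) (hT n).summable, (hT n).tsum_eq,
      intervalIntegral.integral_of_le zero_le_one, ofReal_integral_eq_lintegral_ofReal
      ((hg n).integrableOn_Ioc) (Filter.Eventually.of_forall (hg0 n))]
  simp_rw [h1]
  rw [← ENNReal.tsum_prod, ENNReal.tsum_toReal_eq fun _ => ENNReal.ofReal_ne_top]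
  exact tsum_congr fun p => ENNReal.toReal_ofReal (hT0 _ _)

section Discrete

variable {lam : ℤ}

/-- The primitive additive character `j ↦ e^{2πij/λ}` of `ℤ/λℤ`. -/
lemma exists_isPrimitive_addChar (hlam : lam ≠ 0) :
    ∃ χ : AddChar (ZMod lam.natAbs) ℂ, χ.IsPrimitive ∧
      ∀ j : ℤ, χ (j : ZMod lam.natAbs) = Complex.exp (2 * π * Complex.I * j / lam) := by
  have : NeZero lam.natAbs := ⟨Int.natAbs_ne_zero.2 hlam⟩
  have hp := ZMod.isPrimitive_stdAddChar lam.natAbs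
  rcases Int.natAbs_eq lam with h | h
  · refine ⟨_, hp, fun j => ?_⟩
    rw [ZMod.stdAddChar_coe]
    conv_rhs => rw [h]
    simp
  · refine ⟨ZMod.stdAddChar.mulShift (-1), fun a ha => ?_, fun j => ?_⟩
    · rw [AddChar.mulShift_mulShift]
      exact hp (by simpa using ha)
    · rw [AddChar.mulShift_apply, neg_one_mul, ← Int.cast_neg, ZMod.stdAddChar_coe]
      conv_rhs => rw [h]
      rw [Int.cast_neg, Int.cast_neg, Int.cast_natCast, div_neg, mul_neg, neg_div]

lemma addChar_intCast_eq_expChar {χ : AddChar (ZMod lam.natAbs) ℂ}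
    (hχ : ∀ j : ℤ, χ (j : ZMod lam.natAbs) = Complex.exp (2 * π * Complex.I * j / lam)) (r m : ℤ) :
    χ ((r : ZMod lam.natAbs) * m) = expChar m (r / lam) := by
  rw [← Int.cast_mul, hχ, expChar]
  push_cast
  ring_nf

/-- Integers decompose as a residue modulo `λ` plus a multiple of `λ`. -/
noncomputable def residueEquiv (hlam : lam ≠ 0) : ZMod lam.natAbs × ℤ ≃ ℤ :=
  Equiv.ofBijective (fun p => (p.1.val : ℤ) + lam * p.2) <| by
    have : NeZero lam.natAbs := ⟨Int.natAbs_ne_zero.2 hlam⟩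
    have h0 : (lam : ZMod lam.natAbs) = 0 := by
      rw [ZMod.intCast_zmod_eq_zero_iff_dvd]; exact Int.natAbs_dvd.2 dvd_rfl
    constructor
    · rintro ⟨r, t⟩ ⟨r', t'⟩ h
      simp only at h
      have hr : r = r' := by
        have := congrArg (Int.cast : ℤ → ZMod lam.natAbs) h
        simpa [h0] using this
      subst hr
      simpa [hlam] using h
    · intro k
      have h1 : lam ∣ k - ((k : ZMod lam.natAbs).val : ℤ) := by
        rw [← Int.natAbs_dvd, ← ZMod.intCast_zmod_eq_zero_iff_dvd]
        simp
      obtain ⟨t, ht⟩ := h1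
      exact ⟨(k, t), by simp only; omega⟩

lemma residueEquiv_apply (hlam : lam ≠ 0) (p : ZMod lam.natAbs × ℤ) :
    residueEquiv hlam p = (p.1.val : ℤ) + lam * p.2 := rfl

lemma intCast_residueEquiv (hlam : lam ≠ 0) (p : ZMod lam.natAbs × ℤ) :
    ((residueEquiv hlam p : ℤ) : ZMod lam.natAbs) = p.1 := by
  have : NeZero lam.natAbs := ⟨Int.natAbs_ne_zero.2 hlam⟩
  have h0 : (lam : ZMod lam.natAbs) = 0 := by
    rw [ZMod.intCast_zmod_eq_zero_iff_dvd]; exact Int.natAbs_dvd.2 dvd_rfl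
  rw [residueEquiv_apply]
  simp [h0]

/-- Quadratic decay is preserved by translation, up to a constant. -/
lemma inv_one_add_sq_add_le (u s : ℝ) :
    (1 + (u + s) ^ 2)⁻¹ ≤ 2 * (1 + s ^ 2) * (1 + u ^ 2)⁻¹ := by
  rw [← div_eq_mul_inv, le_div_iff₀ (by positivity), inv_mul_le_iff₀ (by positivity)]
  nlinarith [sq_nonneg (u + 2 * s), sq_nonneg (s * (u + s)), sq_nonneg (u + s)]

lemma summable_inv_one_add_sq_div (hlam : lam ≠ 0) (a : ℝ) :
    Summable fun k : ℤ => (1 + ((k : ℝ) / lam + a) ^ 2)⁻¹ := by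
  have hl : (0 : ℝ) < (lam : ℝ) ^ 2 := by
    have : (lam : ℝ) ≠ 0 := by exact_mod_cast hlam
    positivity
  have h1 : Summable fun k : ℤ => (lam : ℝ) ^ 2 * |(k : ℝ)| ^ (-2 : ℝ) :=
    (Real.summable_abs_int_rpow one_lt_two).mul_left _
  have h2 : Summable fun k : ℤ => (1 + ((k : ℝ) / lam) ^ 2)⁻¹ := by
    refine h1.of_norm_bounded_eventually ?_
    have h0 : ∀ᶠ k : ℤ in Filter.cofinite, k ≠ 0 := by
      simpa using (Set.finite_singleton (0 : ℤ)).compl_mem_cofinite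
    filter_upwards [h0] with k hk
    have hk' : (k : ℝ) ≠ 0 := by exact_mod_cast hk
    rw [Real.norm_of_nonneg (by positivity), Real.rpow_neg (abs_nonneg _)]
    norm_num
    rw [← div_eq_mul_inv, le_div_iff₀ (by positivity), inv_mul_le_iff₀ (by positivity)]
    have : ((k : ℝ) / lam) ^ 2 * lam ^ 2 = (k : ℝ) ^ 2 := by
      rw [div_pow, div_mul_cancel₀ _ hl.ne']
    linarith
  refine (h2.mul_left (2 * (1 + a ^ 2))).of_nonneg_of_le (fun k => by positivity) fun k => ?_
  exact inv_one_add_sq_add_le _ _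

lemma tsum_mul_comp_div (hlam : lam ≠ 0) [NeZero lam.natAbs] (W : ZMod lam.natAbs → ℂ) {ψ : ℝ → ℂ}
    {C : ℝ} (hψ : ∀ u, ‖ψ u‖ ≤ C * (1 + u ^ 2)⁻¹) (a : ℝ) :
    ∑' k : ℤ, W k * ψ ((k : ℝ) / lam + a) =
      ∑' t : ℤ, ∑ r : ZMod lam.natAbs, W r * ψ ((a + t) + (r.val : ℝ) / lam) := by
  have hl : (lam : ℝ) ≠ 0 := by exact_mod_cast hlam
  have hs : Summable fun k : ℤ => W k * ψ ((k : ℝ) / lam + a) := by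
    refine Summable.of_norm_bounded
      (((summable_inv_one_add_sq_div hlam a).mul_left C).mul_left (∑ r, ‖W r‖)) fun k => ?_
    rw [norm_mul]
    gcongr
    · exact Finset.single_le_sum (f := fun r => ‖W r‖) (fun r _ => norm_nonneg _)
        (Finset.mem_univ _)
    · exact hψ _
  have h1 := (residueEquiv hlam).tsum_eq (fun k : ℤ => W k * ψ ((k : ℝ) / lam + a))
  have hs' := (residueEquiv hlam).summable_iff.2 hs
  have h2 := ((Equiv.prodComm _ _).summable_iff.2 hs').tsum_prod
  simp only [Function.comp_apply] at h2
  rw [← h1, ← (Equiv.prodComm _ _).tsum_eq, h2]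
  refine tsum_congr fun t => ?_
  rw [tsum_fintype]
  refine Finset.sum_congr rfl fun r _ => ?_
  simp only [Equiv.prodComm_apply, Prod.swap_prod_mk, intCast_residueEquiv]
  rw [residueEquiv_apply]
  congr 2
  push_cast
  field_simp
  ring

open FourierTransform in
lemma fourier_sum_comp_add {N : ℕ} [NeZero N] (W : ZMod N → ℂ) (s : ZMod N → ℝ) {ψ : ℝ → ℂ}
    (hψ : Integrable ψ) (m : ℤ) :
    𝓕 (fun u : ℝ => ∑ r, W r * ψ (u + s r)) (m : ℝ) =
      (∑ r, W r * expChar m (s r)) * 𝓕 ψ (m : ℝ) := by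
  simp only [Real.fourier_real_eq_integral_exp_smul, smul_eq_mul]
  have hexp : ∀ v : ℝ, Complex.exp (((-2 * π * v * (m : ℝ) : ℝ) : ℂ) * Complex.I) =
      expChar (-m) v := fun v => by
    rw [expChar]; congr 1; push_cast; ring
  simp_rw [hexp, Finset.mul_sum]
  have hmul : ∀ g : ℝ → ℂ, Integrable g → Integrable fun v => expChar (-m) v * g v := fun g hg =>
    hg.bdd_mul (c := 1) (continuous_expChar _).aestronglyMeasurable
      (Filter.Eventually.of_forall fun v => (norm_expChar _ _).le)
  rw [integral_finsetSum _ fun r _ => hmul _ ((hψ.comp_add_right (s r)).const_mul (W r)),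
    Finset.sum_mul]
  refine Finset.sum_congr rfl fun r _ => ?_
  rw [← integral_const_mul, ← integral_add_right_eq_self (fun v =>
    W r * expChar m (s r) * (expChar (-m) v * ψ v)) (s r)]
  congr 1
  ext v
  have h : expChar (-m) v = expChar m (s r) * expChar (-m) (v + s r) := by
    simp only [expChar, ← Complex.exp_add]
    congr 1
    push_cast
    ring
  rw [h]
  ring

/-- The discrete Fourier transform turns modulated autocorrelations into one another. -/
lemma norm_sum_dft_autocorrelation {N : ℕ} [NeZero N] {χ : AddChar (ZMod N) ℂ}
    (hχ : χ.IsPrimitive) (γ : ZMod N → ℂ) (n m : ZMod N) :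
    ‖∑ r, (∑ q, γ q * χ (-(q * r))) * conj (∑ q, γ q * χ (-(q * (r - n)))) * χ (r * m)‖ =
      N * ‖∑ q, γ q * conj (γ (q - m)) * χ (q * -n)‖ := by
  have h1 : ∀ r, (∑ q, γ q * χ (-(q * r))) * conj (∑ q, γ q * χ (-(q * (r - n)))) * χ (r * m) =
      ∑ q, ∑ p, γ q * conj (γ p) * χ (-(p * n)) * χ (r * (p - (q - m))) := by
    intro r
    rw [map_sum, Finset.sum_mul_sum, Finset.sum_mul]
    refine Finset.sum_congr rfl fun q _ => ?_
    rw [Finset.sum_mul]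
    refine Finset.sum_congr rfl fun p _ => ?_
    rw [map_mul, ← AddChar.map_neg_eq_conj, neg_neg,
      show r * (p - (q - m)) = p * r + (-(q * r) + r * m) by ring,
      show p * (r - n) = p * r + -(p * n) by ring]
    simp only [AddChar.map_add_eq_mul]
    ring
  simp_rw [h1]
  rw [Finset.sum_comm]
  have h2 : ∀ q, ∑ r, ∑ p, γ q * conj (γ p) * χ (-(p * n)) * χ (r * (p - (q - m))) =
      N * χ (m * n) * (γ q * conj (γ (q - m)) * χ (q * -n)) := by
    intro q
    rw [Finset.sum_comm, Finset.sum_eq_single (q - m)]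
    · simp only [sub_self, mul_zero, AddChar.map_zero_eq_one, mul_one, Finset.sum_const,
        Finset.card_univ, ZMod.card, nsmul_eq_mul]
      rw [show -((q - m) * n) = m * n + q * -n by ring, AddChar.map_add_eq_mul]
      ring
    · intro p _ hp
      rw [← Finset.mul_sum, AddChar.sum_mulShift _ hχ, if_neg (by rwa [sub_eq_zero])]
      simp
    · simp
  simp_rw [h2]
  rw [← Finset.mul_sum, norm_mul, norm_mul, χ.norm_apply]
  simp

end Discrete

section HermiteBWZ

variable {lam : ℤ}

lemma continuous_hermiteScaled (n : ℕ) (lam : ℤ) : Continuous (hermiteScaled n lam) := by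
  unfold hermiteScaled
  exact continuous_const.mul ((continuous_hermiteFun n).comp (by fun_prop))

lemma one_le_two_pi_mul_abs (hlam : lam ≠ 0) : 1 ≤ 2 * π * |(lam : ℝ)| := by
  have h1 : (1 : ℝ) ≤ |(lam : ℝ)| := by exact_mod_cast Int.one_le_abs hlam
  nlinarith [Real.pi_gt_three]

lemma exists_abs_hermiteScaled_le (hlam : lam ≠ 0) (n : ℕ) :
    ∃ C : ℝ, 0 ≤ C ∧ ∀ u : ℝ, |hermiteScaled n lam u| ≤ C * (1 + u ^ 2)⁻¹ := by
  obtain ⟨C, hC, h⟩ := exists_abs_hermiteFun_le n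
  have h1 := one_le_two_pi_mul_abs hlam
  refine ⟨(2 * π * |(lam : ℝ)|) ^ ((1 : ℝ) / 4) * C, by positivity, fun u => ?_⟩
  rw [hermiteScaled, abs_mul, abs_of_nonneg (by positivity),
    mul_assoc ((2 * π * |(lam : ℝ)|) ^ ((1 : ℝ) / 4)) C]
  refine mul_le_mul_of_nonneg_left ((h _).trans ?_) (by positivity)
  rw [mul_pow, Real.sq_sqrt (by positivity)]
  gcongr
  nlinarith [sq_nonneg u]

/-- The product of a scaled Hermite function with one of its translates. -/
noncomputable def hermiteProd (ℓ : ℕ) (lam n : ℤ) (u : ℝ) : ℂ :=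
  (hermiteScaled ℓ lam u : ℂ) * (hermiteScaled ℓ lam (u - n / lam) : ℂ)

lemma continuous_hermiteProd (ℓ : ℕ) (lam n : ℤ) : Continuous (hermiteProd ℓ lam n) := by
  have h := continuous_hermiteScaled ℓ lam
  unfold hermiteProd
  fun_prop

lemma exists_norm_hermiteProd_le (hlam : lam ≠ 0) (ℓ : ℕ) (n : ℤ) :
    ∃ C : ℝ, 0 ≤ C ∧ ∀ u : ℝ, ‖hermiteProd ℓ lam n u‖ ≤ C * (1 + u ^ 2)⁻¹ := by
  obtain ⟨C, hC, h⟩ := exists_abs_hermiteScaled_le hlam ℓ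
  refine ⟨C * C, by positivity, fun u => ?_⟩
  rw [hermiteProd, norm_mul, Complex.norm_real, Complex.norm_real, Real.norm_eq_abs,
    Real.norm_eq_abs]
  have h1 : |hermiteScaled ℓ lam (u - n / lam)| ≤ C :=
    (h _).trans (mul_le_of_le_one_right hC (inv_le_one_of_one_le₀ (by nlinarith [sq_nonneg (u - n / lam)])))
  calc _ ≤ C * (1 + u ^ 2)⁻¹ * C := by gcongr; exact h u
    _ = _ := by ring

lemma integrable_of_quadratic_decay {f : ℝ → ℂ} (hc : Continuous f) {C : ℝ}
    (hf : ∀ u, ‖f u‖ ≤ C * (1 + u ^ 2)⁻¹) : Integrable f :=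
  (integrable_inv_one_add_sq.const_mul C).mono' hc.aestronglyMeasurable
    (Filter.Eventually.of_forall hf)

open FourierTransform in
lemma norm_fourier_hermiteProd (hlam : lam ≠ 0) (ℓ : ℕ) (n m : ℤ) :
    ‖𝓕 (hermiteProd ℓ lam n) (m : ℝ)‖ =
      |laguerreFun ℓ (π * ((n : ℝ) ^ 2 + (m : ℝ) ^ 2) / |(lam : ℝ)|)| := by
  have hl : 0 < |(lam : ℝ)| := by
    have : (lam : ℝ) ≠ 0 := by exact_mod_cast hlam
    positivity
  have hl' : (lam : ℝ) ≠ 0 := by exact_mod_cast hlam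
  set D := 2 * π * |(lam : ℝ)| with hD
  have hD0 : 0 < D := by positivity
  set σ := Real.sqrt D with hσ
  have hσ0 : 0 < σ := Real.sqrt_pos.2 hD0
  have hσ2 : σ ^ 2 = D := Real.sq_sqrt hD0.le
  set κ := D ^ ((1 : ℝ) / 4) with hκ
  have hκ2 : κ ^ 2 = σ := by
    rw [hκ, hσ, Real.sqrt_eq_rpow, ← Real.rpow_natCast, ← Real.rpow_mul hD0.le]
    norm_num
  set x := σ * (-(n / lam : ℝ)) with hx
  set y := 2 * π * m / σ with hy
  set g : ℝ → ℂ := fun v => (hermiteFun ℓ (v + x) : ℂ) * (hermiteFun ℓ v : ℂ) *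
    Complex.exp (-(y * v * Complex.I)) with hg
  have h1 : 𝓕 (hermiteProd ℓ lam n) (m : ℝ) = ∫ u : ℝ, (κ : ℂ) ^ 2 * g (σ * u) := by
    rw [Real.fourier_real_eq_integral_exp_smul]
    congr 1
    ext u
    rw [smul_eq_mul, hermiteProd, hermiteScaled, hermiteScaled, hg]
    simp only
    rw [← hD, ← hσ, ← hκ, show σ * (u - n / lam) = σ * u + x by rw [hx]; ring]
    have hσc : (σ : ℂ) ≠ 0 := by exact_mod_cast hσ0.ne'
    have h2 : Complex.exp (((-2 * π * u * (m : ℝ) : ℝ) : ℂ) * Complex.I) =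
        Complex.exp (-(y * ((σ * u : ℝ) : ℂ) * Complex.I)) := by
      congr 1
      rw [hy]
      push_cast
      field_simp
    rw [h2]
    push_cast
    ring
  rw [h1, integral_const_mul, Measure.integral_comp_mul_left, norm_mul, norm_smul,
    norm_integral_hermiteFun_mul, norm_pow, Complex.norm_real, Real.norm_eq_abs, sq_abs, hκ2,
    Real.norm_eq_abs, abs_abs, abs_of_pos (inv_pos.2 hσ0), ← mul_assoc, mul_inv_cancel₀ hσ0.ne',
    one_mul]
  congr 2
  rw [hx, hy, mul_pow, neg_sq, div_pow, div_pow, hσ2, hD, ← sq_abs (lam : ℝ)]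
  field_simp

/-- The discrete Fourier transform of `γ` with respect to the character `χ`. -/
noncomputable def charTransform {N : ℕ} [NeZero N] (χ : AddChar (ZMod N) ℂ) (γ : ZMod N → ℂ)
    (r : ZMod N) : ℂ :=
  ∑ q, γ q * χ (-(q * r))

/-- The coefficients of `∑ q, γ q * h_{λ,q,ℓ}(a, ·, c)` as a Fourier series. -/
noncomputable def bwzCoeff [NeZero lam.natAbs] (χ : AddChar (ZMod lam.natAbs) ℂ)
    (γ : ZMod lam.natAbs → ℂ) (ℓ : ℕ) (a : ℝ) (k : ℤ) : ℂ :=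
  ((Real.sqrt |(lam : ℝ)| : ℝ) / (lam : ℝ) : ℝ) * charTransform χ γ k *
    (hermiteScaled ℓ lam (k / lam + a) : ℂ)

lemma summable_norm_hermiteScaled (hlam : lam ≠ 0) (ℓ : ℕ) (a : ℝ) :
    Summable fun k : ℤ => ‖(hermiteScaled ℓ lam (k / lam + a) : ℂ)‖ := by
  obtain ⟨C, -, h⟩ := exists_abs_hermiteScaled_le hlam ℓ
  refine ((summable_inv_one_add_sq_div hlam a).mul_left C).of_nonneg_of_le
    (fun k => norm_nonneg _) fun k => ?_
  rw [Complex.norm_real]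
  exact h _

lemma summable_norm_bwzCoeff (hlam : lam ≠ 0) [NeZero lam.natAbs] (χ : AddChar (ZMod lam.natAbs) ℂ)
    (γ : ZMod lam.natAbs → ℂ) (ℓ : ℕ) (a : ℝ) : Summable fun k => ‖bwzCoeff χ γ ℓ a k‖ := by
  refine ((summable_norm_hermiteScaled hlam ℓ a).mul_left
    (‖(((Real.sqrt |(lam : ℝ)| : ℝ) / (lam : ℝ) : ℝ) : ℂ)‖ * ∑ r, ‖charTransform χ γ r‖)).of_nonneg_of_le
    (fun k => norm_nonneg _) fun k => ?_
  rw [bwzCoeff, norm_mul, norm_mul]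
  gcongr
  exact Finset.single_le_sum (f := fun r => ‖charTransform χ γ r‖) (fun r _ => norm_nonneg _)
    (Finset.mem_univ _)

lemma norm_sum_hBWZ (hlam : lam ≠ 0) [NeZero lam.natAbs] {χ : AddChar (ZMod lam.natAbs) ℂ}
    (hχ : ∀ j : ℤ, χ (j : ZMod lam.natAbs) = Complex.exp (2 * π * Complex.I * j / lam))
    (γ : ZMod lam.natAbs → ℂ) (ℓ : ℕ) (a b c : ℝ) :
    ‖∑' q : ZMod lam.natAbs, γ q * hBWZ lam (q.val : ℤ) ℓ (a, b, c)‖ =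
      ‖∑' k, bwzCoeff χ γ ℓ a k * expChar k b‖ := by
  set s : ℂ := (((Real.sqrt |(lam : ℝ)| : ℝ) / (lam : ℝ) : ℝ) : ℂ) with hs
  have h1 : ∀ q : ZMod lam.natAbs, γ q * hBWZ lam (q.val : ℤ) ℓ (a, b, c) =
      expChar lam c * ∑' k : ℤ, s * (γ q * χ (-(q * k))) *
        (hermiteScaled ℓ lam (k / lam + a) : ℂ) * expChar k b := by
    intro q
    rw [hBWZ, BWZ, ← tsum_mul_left, ← tsum_mul_left, ← tsum_mul_left]
    refine tsum_congr fun k => ?_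
    have h2 : χ (-(q * k)) =
        Complex.exp (-(2 * (π : ℂ) * Complex.I * ((q.val : ℤ) : ℂ) * (k : ℂ)) / (lam : ℂ)) := by
      have : -(q * k) = ((-((q.val : ℤ) * k) : ℤ) : ZMod lam.natAbs) := by simp
      rw [this, hχ]
      congr 1
      push_cast
      ring
    have h3 : Complex.exp (2 * (π : ℂ) * Complex.I * ((lam : ℂ) * (c : ℂ) + (k : ℂ) * (b : ℂ))) =
        expChar lam c * expChar k b := by
      rw [expChar, expChar, ← Complex.exp_add, mul_add]
    simp only
    rw [h2, h3]
    ring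
  have h4 : ∀ q : ZMod lam.natAbs, Summable fun k : ℤ => s * (γ q * χ (-(q * k))) *
      (hermiteScaled ℓ lam (k / lam + a) : ℂ) * expChar k b := by
    intro q
    refine Summable.of_norm (((summable_norm_hermiteScaled hlam ℓ a).mul_left (‖s‖ * ‖γ q‖)).congr
      fun k => ?_)
    rw [norm_mul, norm_mul, norm_mul, norm_mul, norm_expChar, χ.norm_apply]
    ring
  rw [tsum_fintype]
  simp_rw [h1]
  rw [← Finset.mul_sum, ← Summable.tsum_finsetSum fun q _ => h4 q, norm_mul, norm_expChar, one_mul]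
  congr 1
  refine tsum_congr fun k => ?_
  rw [bwzCoeff, charTransform, ← hs, Finset.mul_sum, Finset.sum_mul, Finset.sum_mul]

/-- The weights in the autocorrelation of `bwzCoeff`. -/
noncomputable def corrWeight {N : ℕ} [NeZero N] (χ : AddChar (ZMod N) ℂ) (γ : ZMod N → ℂ)
    (n r : ZMod N) : ℂ :=
  (N : ℂ)⁻¹ * (charTransform χ γ r * conj (charTransform χ γ (r - n)))

/-- The function whose periodization is the `n`-th autocorrelation of `bwzCoeff`. -/
noncomputable def corrFun [NeZero lam.natAbs] (χ : AddChar (ZMod lam.natAbs) ℂ)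
    (γ : ZMod lam.natAbs → ℂ) (ℓ : ℕ) (n : ℤ) : C(ℝ, ℂ) where
  toFun u := ∑ r : ZMod lam.natAbs, corrWeight χ γ n r *
    hermiteProd ℓ lam n (u + (r.val : ℝ) / lam)
  continuous_toFun := by
    have h := continuous_hermiteProd ℓ lam n
    fun_prop

lemma exists_norm_corrFun_le (hlam : lam ≠ 0) [NeZero lam.natAbs] (χ : AddChar (ZMod lam.natAbs) ℂ)
    (γ : ZMod lam.natAbs → ℂ) (ℓ : ℕ) (n : ℤ) :
    ∃ C : ℝ, ∀ u : ℝ, ‖corrFun χ γ ℓ n u‖ ≤ C * (1 + u ^ 2)⁻¹ := by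
  obtain ⟨C, hC, h⟩ := exists_norm_hermiteProd_le hlam ℓ n
  refine ⟨∑ r : ZMod lam.natAbs, ‖corrWeight χ γ n r‖ *
    (C * (2 * (1 + ((r.val : ℝ) / lam) ^ 2))), fun u => ?_⟩
  rw [Finset.sum_mul]
  refine norm_sum_le_of_le _ fun r _ => ?_
  rw [norm_mul, mul_assoc]
  gcongr
  refine (h _).trans ?_
  rw [mul_assoc]
  gcongr
  exact inv_one_add_sq_add_le _ _

lemma tsum_bwzCoeff_autocorrelation (hlam : lam ≠ 0) [NeZero lam.natAbs]
    (χ : AddChar (ZMod lam.natAbs) ℂ) (γ : ZMod lam.natAbs → ℂ) (ℓ : ℕ) (n : ℤ) (a : ℝ) :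
    ∑' k, bwzCoeff χ γ ℓ a k * conj (bwzCoeff χ γ ℓ a (k - n)) =
      ∑' t : ℤ, corrFun χ γ ℓ n (a + t) := by
  obtain ⟨C, -, h⟩ := exists_norm_hermiteProd_le hlam ℓ n
  refine Eq.trans (tsum_congr fun k => ?_) (tsum_mul_comp_div hlam (corrWeight χ γ n) h a)
  have hs : ((((Real.sqrt |(lam : ℝ)| : ℝ) / (lam : ℝ) : ℝ) : ℂ)) ^ 2 = (lam.natAbs : ℂ)⁻¹ := by
    have h1 : ((lam.natAbs : ℕ) : ℂ) = ((|(lam : ℝ)| : ℝ) : ℂ) := by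
      rw [← Int.cast_abs, Int.abs_eq_natAbs, Int.cast_natCast, ofReal_natCast]
    have h2 : |(lam : ℝ)| ≠ 0 := by
      have : (lam : ℝ) ≠ 0 := by exact_mod_cast hlam
      positivity
    rw [h1, ← ofReal_pow, ← ofReal_inv, div_pow, Real.sq_sqrt (abs_nonneg _), ← sq_abs (lam : ℝ)]
    congr 1
    field_simp
  rw [bwzCoeff, bwzCoeff, corrWeight, hermiteProd, ← hs]
  simp only [map_mul, conj_ofReal]
  rw [show (((k - n : ℤ) : ℝ) / lam + a) = (k / lam + a - n / lam) by push_cast; ring, Int.cast_sub]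
  ring

open FourierTransform in
lemma norm_fourier_corrFun (hlam : lam ≠ 0) [NeZero lam.natAbs] {χ : AddChar (ZMod lam.natAbs) ℂ}
    (hp : χ.IsPrimitive)
    (hχ : ∀ j : ℤ, χ (j : ZMod lam.natAbs) = Complex.exp (2 * π * Complex.I * j / lam))
    (γ : ZMod lam.natAbs → ℂ) (ℓ : ℕ) (n m : ℤ) :
    ‖𝓕 (corrFun χ γ ℓ n : ℝ → ℂ) (m : ℝ)‖ =
      ‖(∑ q, γ q * conj (γ (q - m)) * χ (q * -n)) *
        (laguerreFun ℓ (π * ((n : ℝ) ^ 2 + (m : ℝ) ^ 2) / |(lam : ℝ)|) : ℂ)‖ := by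
  obtain ⟨C, -, h⟩ := exists_norm_hermiteProd_le hlam ℓ n
  have hN : (lam.natAbs : ℝ) ≠ 0 := by exact_mod_cast NeZero.ne lam.natAbs
  change ‖𝓕 (fun u : ℝ => ∑ r : ZMod lam.natAbs, corrWeight χ γ n r *
    hermiteProd ℓ lam n (u + (r.val : ℝ) / lam)) (m : ℝ)‖ = _
  rw [fourier_sum_comp_add _ (fun r : ZMod lam.natAbs => (r.val : ℝ) / lam)
    (integrable_of_quadratic_decay (continuous_hermiteProd ℓ lam n) h), norm_mul, norm_mul,
    norm_fourier_hermiteProd hlam, Complex.norm_real, Real.norm_eq_abs]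
  congr 1
  have h1 : ∀ r : ZMod lam.natAbs, expChar m ((r.val : ℝ) / lam) = χ (r * m) := fun r => by
    have := addChar_intCast_eq_expChar hχ (r.val : ℤ) m
    simpa using this.symm
  simp_rw [h1, corrWeight, mul_assoc ((lam.natAbs : ℂ)⁻¹)]
  rw [← Finset.mul_sum, norm_mul]
  simp only [charTransform]
  rw [norm_sum_dft_autocorrelation hp, norm_inv, Complex.norm_natCast, inv_mul_cancel_left₀ hN]

end HermiteBWZ

/-- **Key L⁴ identity for Hermite–BWZ eigenfunctions.** -/
theorem hermite_BWZ_L4_identity (lam : ℤ) (hlam : lam ≠ 0) (ℓ : ℕ)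
    (γ : ZMod lam.natAbs → ℂ) :
    (∫ a in Set.Icc (0:ℝ) 1, ∫ b in Set.Icc (0:ℝ) 1, ∫ c in Set.Icc (0:ℝ) 1,
        ‖∑' q : ZMod lam.natAbs, γ q * hBWZ lam (q.val : ℤ) ℓ (a, b, c)‖ ^ 4)
      = ∑' ab : ℤ × ℤ,
          ‖(∑' q : ZMod lam.natAbs,
                γ q * conj (γ (q - (ab.2 : ZMod lam.natAbs))) *
                  Complex.exp (2 * (π : ℂ) * Complex.I * (q.val : ℂ) * (ab.1 : ℂ) / (lam : ℂ))) *
              (laguerreFun ℓ (π * ((ab.1 : ℝ) ^ 2 + (ab.2 : ℝ) ^ 2) / |(lam : ℝ)|) : ℂ)‖ ^ 2 := by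
  have : NeZero lam.natAbs := ⟨Int.natAbs_ne_zero.2 hlam⟩
  obtain ⟨χ, hp, hχ⟩ := exists_isPrimitive_addChar hlam
  simp_rw [norm_sum_hBWZ hlam hχ, setIntegral_const, integral_Icc_eq_integral_Ioc,
    ← intervalIntegral.integral_of_le (zero_le_one' ℝ)]
  simp only [Real.volume_real_Icc_of_le zero_le_one, sub_zero, one_smul]
  have hL := integral_eq_tsum_prod_of_hasSum
    (g := fun n a => ‖∑' t : ℤ, corrFun χ γ ℓ n (a + t)‖ ^ 2)
    (G := fun a => ∫ b in (0:ℝ)..1, ‖∑' k, bwzCoeff χ γ ℓ a k * expChar k b‖ ^ 4)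
    (T := fun n m => ‖FourierTransform.fourier (corrFun χ γ ℓ n : ℝ → ℂ) (m : ℝ)‖ ^ 2)
    (fun n => by
      obtain ⟨C, h⟩ := exists_norm_corrFun_le hlam χ γ ℓ n
      exact (continuous_periodization h).norm.pow 2)
    (fun n a => by positivity) (fun n m => by positivity)
    (fun a => by
      simp_rw [← tsum_bwzCoeff_autocorrelation hlam]
      exact hasSum_sq_norm_autocorrelation (summable_norm_bwzCoeff hlam χ γ ℓ a))
    (fun n => by
      obtain ⟨C, h⟩ := exists_norm_corrFun_le hlam χ γ ℓ n
      exact hasSum_sq_norm_fourier_periodization h)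
  rw [hL, ← ((Equiv.neg ℤ).prodCongr (Equiv.refl ℤ)).tsum_eq]
  refine tsum_congr fun ab => ?_
  simp only [Equiv.prodCongr_apply, Prod.map_fst, Prod.map_snd, Equiv.neg_apply, Equiv.refl_apply]
  rw [norm_fourier_corrFun hlam hp hχ, tsum_fintype]
  have h1 : ∀ q : ZMod lam.natAbs, χ (q * -((-ab.1 : ℤ) : ZMod lam.natAbs)) =
      Complex.exp (2 * (π : ℂ) * Complex.I * (q.val : ℂ) * (ab.1 : ℂ) / (lam : ℂ)) := by
    intro q
    have : q * -((-ab.1 : ℤ) : ZMod lam.natAbs) = (((q.val : ℤ) * ab.1 : ℤ) : ZMod lam.natAbs) := by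
      simp
    rw [this, hχ]
    congr 1
    push_cast
    ring
  simp_rw [h1, Int.cast_neg, neg_sq]
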